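/- Let k be a field of characteristic zero, let A be a unital commutative associative k-algebra, and let V = Der_k(A). For each q ≥ 0 the assignment Φ_q(f dg₁∧⋯∧dg_q)(η₁∧⋯∧η_q) = f·det(η_j(g_i))_{1≤i,j≤q} defines an A-module map Φ_q: Ω^q_{A/k} → Hom_A(Λ^q_A V, A), and these maps satisfy d ∘ Φ_q = Φ_{q+1} ∘ (−d_dR), where d is the Chevalley–Eilenberg differential on A-linear cochains C_A^*(V,A). -/

import Mathlib

set_option linter.unusedSectionVars false
set_option maxHeartbeats 1000000


noncomputable section

open Finset

namespace GF

section CE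

variable (k : Type*) [CommRing k]
variable (L : Type*) [LieRing L] [LieAlgebra k L]
variable (M : Type*) [AddCommGroup M] [Module k M] [LieRingModule L M] [LieModule k L M]

/-- The `q`-tuple `([ξ_s, ξ_t], ξ_0, …, ξ̂_s, …, ξ̂_t, …, ξ_q)` obtained from a
`(q+1)`-tuple `ξ` by removing the entries at positions `s < t` and prepending the bracket. -/
def ceTuple' {L : Type*} [LieRing L] {q : ℕ} (ξ : Fin (q + 1) → L) (s t : Fin (q + 1)) :
    Fin q → L :=
  fun i =>
    if i.val = 0 then ⁅ξ s, ξ t⁆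
    else if i.val - 1 < s.val then ξ ⟨i.val - 1, by have := i.isLt; omega⟩
    else if i.val < t.val then ξ ⟨i.val, by have := i.isLt; omega⟩
    else ξ ⟨i.val + 1, by have := i.isLt; omega⟩

/-- The Chevalley–Eilenberg differential, as a linear map on the space of all
functions `(Fin q → L) → M`:
`(dφ)(ξ₁,…,ξ_{q+1}) = Σ_{s<t} (−1)^{s+t−1} φ([ξ_s,ξ_t], ξ₁,…,ξ̂_s,…,ξ̂_t,…,ξ_{q+1})
  + Σ_s (−1)^s ξ_s·φ(ξ₁,…,ξ̂_s,…,ξ_{q+1})` (written here with `0`-based indices). -/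
def ceDiff (q : ℕ) : ((Fin q → L) → M) →ₗ[k] ((Fin (q + 1) → L) → M) where
  toFun φ := fun ξ =>
    (∑ s : Fin (q + 1), ∑ t : Fin (q + 1),
      if s < t then ((-1 : ℤ) ^ (s.val + t.val + 1)) • φ (ceTuple' ξ s t) else 0)
    + ∑ s : Fin (q + 1), ((-1 : ℤ) ^ (s.val + 1)) • ⁅ξ s, φ (fun i => ξ (s.succAbove i))⁆
  map_add' φ ψ := by
    funext ξ
    have aux : ∀ (P : Prop) [Decidable P] (a b : M),
        (if P then a + b else 0) = (if P then a else 0) + (if P then b else 0) := by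
      intros P _ a b; split <;> simp
    simp only [Pi.add_apply, lie_add, smul_add, aux, Finset.sum_add_distrib]
    abel
  map_smul' c φ := by
    funext ξ
    have aux : ∀ (P : Prop) [Decidable P] (z : ℤ) (a : M),
        (if P then z • c • a else 0) = c • (if P then z • a else 0) := by
      intros P _ z a; split <;> simp [smul_comm c z]
    have aux2 : ∀ (z : ℤ) (a : M), z • c • a = c • z • a := fun z a => smul_comm z c a
    have aux3 : ∀ (P : Prop) [Decidable P] (a : M),
        (if P then c • a else 0) = c • (if P then a else 0) := by
      intros P _ a; split <;> simp
    simp only [Pi.smul_apply, RingHom.id_apply, lie_smul, aux, aux2, aux3,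
      ← Finset.smul_sum, ← smul_add]

/-- Alternating multilinear (over `k`) functions: the underlying property of
Chevalley–Eilenberg cochains. -/
def IsAltML (q : ℕ) (φ : (Fin q → L) → M) : Prop :=
  (∀ (ξ : Fin q → L) (i : Fin q) (x y : L),
      φ (Function.update ξ i (x + y)) = φ (Function.update ξ i x) + φ (Function.update ξ i y)) ∧
  (∀ (ξ : Fin q → L) (i : Fin q) (c : k) (x : L),
      φ (Function.update ξ i (c • x)) = c • φ (Function.update ξ i x)) ∧
  (∀ (ξ : Fin q → L) (i j : Fin q), i ≠ j → ξ i = ξ j → φ ξ = 0)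

/-- The space `C^q(L,M)` of Chevalley–Eilenberg cochains: alternating `k`-multilinear
maps `L^q → M`. -/
def ceCochain (q : ℕ) : Submodule k ((Fin q → L) → M) where
  carrier := {φ | IsAltML k L M q φ}
  add_mem' := by
    rintro φ ψ ⟨h1, h2, h3⟩ ⟨g1, g2, g3⟩
    refine ⟨?_, ?_, ?_⟩
    · intro ξ i x y
      simp only [Pi.add_apply, h1 ξ i x y, g1 ξ i x y]; abel
    · intro ξ i c x
      simp only [Pi.add_apply, h2 ξ i c x, g2 ξ i c x, smul_add]
    · intro ξ i j hij hξ
      simp only [Pi.add_apply, h3 ξ i j hij hξ, g3 ξ i j hij hξ, add_zero]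
  zero_mem' := by
    refine ⟨?_, ?_, ?_⟩ <;> intros <;> simp
  smul_mem' := by
    rintro c φ ⟨h1, h2, h3⟩
    refine ⟨?_, ?_, ?_⟩
    · intro ξ i x y
      simp only [Pi.smul_apply, h1 ξ i x y, smul_add]
    · intro ξ i d x
      simp only [Pi.smul_apply, h2 ξ i d x, smul_comm c d]
    · intro ξ i j hij hξ
      simp only [Pi.smul_apply, h3 ξ i j hij hξ, smul_zero]

/-- Cocycles: cochains killed by the Chevalley–Eilenberg differential. -/
def ceCocycles (q : ℕ) : Submodule k ((Fin q → L) → M) :=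
  ceCochain k L M q ⊓ LinearMap.ker (ceDiff k L M q)

/-- Coboundaries: images of cochains under the Chevalley–Eilenberg differential
(there are none in degree `0`). -/
def ceCoboundaries : (q : ℕ) → Submodule k ((Fin q → L) → M)
  | 0 => ⊥
  | (r + 1) => ceCochain k L M (r + 1) ⊓ Submodule.map (ceDiff k L M r) (ceCochain k L M r)

/-- Lie algebra cohomology `H^q(L, M)`, defined via the Chevalley–Eilenberg complex of
alternating multilinear cochains. -/
abbrev lieCohomology (q : ℕ) :=
  ceCocycles k L M q ⧸
    Submodule.comap (ceCocycles k L M q).subtype (ceCoboundaries k L M q)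

end CE

end GF
namespace GF

section Alin

variable (k : Type*) [CommRing k]
variable (A : Type*) [CommRing A] [Algebra k A]
variable (L : Type*) [LieRing L] [LieAlgebra k L] [Module A L]
variable (M : Type*) [AddCommGroup M] [Module k M] [Module A M] [IsScalarTower k A M]
  [LieRingModule L M] [LieModule k L M]

/-- `A`-multilinearity of a cochain: `φ(f₁ξ₁,…,f_qξ_q) = f₁⋯f_q • φ(ξ₁,…,ξ_q)`. -/
def IsAML (q : ℕ) (φ : (Fin q → L) → M) : Prop :=
  ∀ (f : Fin q → A) (ξ : Fin q → L),
    φ (fun i => f i • ξ i) = (∏ i, f i) • φ ξ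

/-- The space `C_A^q(L,M)` of `A`-multilinear Chevalley–Eilenberg cochains. -/
def ceCochainA (q : ℕ) : Submodule k ((Fin q → L) → M) :=
  ceCochain k L M q ⊓
    { carrier := {φ | IsAML A L M q φ}
      add_mem' := by
        intro φ ψ hφ hψ
        intro f ξ
        simp only [Pi.add_apply, hφ f ξ, hψ f ξ, smul_add]
      zero_mem' := by intro f ξ; simp
      smul_mem' := by
        intro c φ hφ
        intro f ξ
        simp only [Pi.smul_apply, hφ f ξ]
        rw [← algebraMap_smul A c (φ ξ), ← algebraMap_smul A c ((∏ i, f i) • φ ξ),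
          smul_comm] }

/-- `A`-linear cocycles. -/
def ceCocyclesA (q : ℕ) : Submodule k ((Fin q → L) → M) :=
  ceCochainA k A L M q ⊓ LinearMap.ker (ceDiff k L M q)

/-- `A`-linear coboundaries. -/
def ceCoboundariesA : (q : ℕ) → Submodule k ((Fin q → L) → M)
  | 0 => ⊥
  | (r + 1) => ceCochainA k A L M (r + 1) ⊓
      Submodule.map (ceDiff k L M r) (ceCochainA k A L M r)

/-- The `A`-linear Lie algebra cohomology `H_A^q(L, M)`. -/
abbrev lieCohomologyA (q : ℕ) :=
  ceCocyclesA k A L M q ⧸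
    Submodule.comap (ceCocyclesA k A L M q).subtype (ceCoboundariesA k A L M q)

end Alin

end GF
namespace GF

section DeRham

variable (k A : Type*) [CommRing k] [CommRing A] [Algebra k A]

/-- The Lie algebra `V = Der_k(A)` acts on `A` by `⁅D, f⁆ = D f`. -/
instance : LieRingModule (Derivation k A A) A where
  bracket D f := D f
  add_lie D E f := by simp
  lie_add D f g := by simp
  leibniz_lie D E f := by
    show D (E f) = ⁅D, E⁆ f + E (D f)
    rw [Derivation.commutator_apply]; abel

instance : LieModule k (Derivation k A A) A where
  smul_lie c D f := by
    show (c • D) f = c • (D f)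
    simp
  lie_smul c D f := by
    show D (c • f) = c • (D f)
    simp

/-- The generator `dg₁ ∧ ⋯ ∧ dg_q` of `Ω^q_{A/k} = Λ^q_A Ω¹_{A/k}`. -/
def wedgeD (q : ℕ) (g : Fin q → A) : ⋀[A]^q (KaehlerDifferential k A) :=
  ⟨ExteriorAlgebra.ιMulti A q (fun i => KaehlerDifferential.D k A (g i)),
    ExteriorAlgebra.ιMulti_range A q (Set.mem_range_self _)⟩

/-- The defining property of the de Rham differential:
`d(f·dg₁∧⋯∧dg_q) = df∧dg₁∧⋯∧dg_q`. -/
def IsDeRhamDiff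
    (d : (q : ℕ) →
      (⋀[A]^q (KaehlerDifferential k A) →ₗ[k] ⋀[A]^(q + 1) (KaehlerDifferential k A))) :
    Prop :=
  ∀ (q : ℕ) (f : A) (g : Fin q → A),
    d q (f • wedgeD k A q g) = wedgeD k A (q + 1) (Fin.cons f g)

/-- de Rham coboundaries, given a de Rham differential family. -/
def deRhamCoboundaries
    (dDR : (q : ℕ) →
      (⋀[A]^q (KaehlerDifferential k A) →ₗ[k] ⋀[A]^(q + 1) (KaehlerDifferential k A))) :
    (q : ℕ) → Submodule k (⋀[A]^q (KaehlerDifferential k A))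
  | 0 => ⊥
  | (r + 1) => LinearMap.range (dDR r)

/-- The algebraic de Rham cohomology `H^q_dR(X)` associated to a de Rham differential
family on `Ω^•_{A/k}` (with `d ∘ d = 0`): the cocycles modulo the coboundaries, realized
as the kernel of the map induced by `d_q` on `Ω^q/B^q`. -/
abbrev deRhamCohomology
    (dDR : (q : ℕ) →
      (⋀[A]^q (KaehlerDifferential k A) →ₗ[k] ⋀[A]^(q + 1) (KaehlerDifferential k A)))
    (hdd : ∀ (r : ℕ) (ω : ⋀[A]^r (KaehlerDifferential k A)), dDR (r + 1) (dDR r ω) = 0)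
    (q : ℕ) :=
  LinearMap.ker (Submodule.liftQ (deRhamCoboundaries k A dDR q) (dDR q)
    (by
      cases q with
      | zero => exact bot_le
      | succ r =>
        rintro x ⟨y, rfl⟩
        exact hdd r y))

end DeRham

end GF

section Determinant

variable {k A : Type*} [CommRing k] [CommRing A] [Algebra k A]

theorem Derivation.map_prod {ι : Type*} [DecidableEq ι] (D : Derivation k A A) (s : Finset ι)
    (f : ι → A) : D (∏ i ∈ s, f i) = ∑ j ∈ s, D (f j) * ∏ i ∈ s.erase j, f i := by
  induction s using Finset.induction_on with
  | empty => simp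
  | insert a s ha ih =>
    rw [Finset.prod_insert ha, Finset.sum_insert ha, Finset.erase_insert ha, D.leibniz, ih]
    simp only [smul_eq_mul, Finset.mul_sum]
    rw [add_comm, mul_comm (D (f a))]
    congr 1
    refine Finset.sum_congr rfl fun j hj => ?_
    have hja : a ≠ j := by rintro rfl; exact ha hj
    rw [Finset.erase_insert_of_ne hja, Finset.prod_insert (by simp [ha])]
    ring

theorem Derivation.map_det {n : Type*} [DecidableEq n] [Fintype n] (D : Derivation k A A)
    (M : Matrix n n A) : D M.det = ∑ j, (M.updateCol j fun i => D (M i j)).det := by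
  simp only [Matrix.det_apply]
  rw [Finset.sum_comm, map_sum]
  refine Finset.sum_congr rfl fun σ _ => ?_
  rw [← Finset.smul_sum, Units.smul_def, Units.smul_def, map_zsmul, D.map_prod]
  congr 1
  refine Finset.sum_congr rfl fun j _ => ?_
  rw [← Finset.mul_prod_erase Finset.univ _ (Finset.mem_univ j), Matrix.updateCol_self]
  congr 1
  refine Finset.prod_congr rfl fun i hi => ?_
  rw [Matrix.updateCol_ne (Finset.ne_of_mem_erase hi)]

/-- Moving column `j` of a matrix to the front multiplies the determinant by `(-1) ^ j`. -/
theorem Matrix.det_updateCol_eq_neg_one_pow_mul_det_cons {n : ℕ}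
    (M : Matrix (Fin (n + 1)) (Fin (n + 1)) A) (j : Fin (n + 1)) (v : Fin (n + 1) → A) :
    (M.updateCol j v).det = (-1) ^ (j : ℕ) *
      (Matrix.of fun i => (Fin.cons (v i) fun l => M i (j.succAbove l) : Fin (n + 1) → A)).det := by
  rw [Matrix.det_succ_column _ j, Matrix.det_succ_column_zero, Finset.mul_sum]
  refine Finset.sum_congr rfl fun i _ => ?_
  rw [Matrix.submatrix_updateCol_succAbove, Matrix.updateCol_self]
  have h : (Matrix.of fun i => (Fin.cons (v i) fun l => M i (j.succAbove l) :
      Fin (n + 1) → A)).submatrix i.succAbove Fin.succ = M.submatrix i.succAbove j.succAbove := by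
    ext a b; simp
  rw [h]
  simp only [Matrix.of_apply, Fin.cons_zero]
  ring

theorem sum_sum_neg_one_pow_succAbove {n : ℕ} (F : Fin (n + 1) → Fin (n + 1) → A) :
    ∑ s : Fin (n + 1), ∑ j : Fin n, (-1) ^ (s.val + j.val) * F s (s.succAbove j) =
      ∑ s : Fin (n + 1), ∑ t : Fin (n + 1),
        if s < t then (-1) ^ (s.val + t.val + 1) * (F s t - F t s) else 0 := by
  have h1 : ∀ s : Fin (n + 1),
      ∑ j : Fin n, (-1) ^ (s.val + j.val) * F s (s.succAbove j) =
        ∑ t : Fin (n + 1), ((if s < t then (-1) ^ (s.val + t.val + 1) * F s t else 0) -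
          (if t < s then (-1) ^ (t.val + s.val + 1) * F s t else 0)) := by
    intro s
    rw [Fin.sum_univ_succAbove _ s]
    simp only [lt_irrefl, if_false, sub_zero, zero_add]
    refine Finset.sum_congr rfl fun j _ => ?_
    rcases lt_or_ge j.castSucc s with h | h
    · rw [Fin.succAbove_of_castSucc_lt _ _ h, if_neg h.not_gt, if_pos h, Fin.val_castSucc]
      ring
    · have h' : s < j.succ := Fin.le_castSucc_iff.mp h
      rw [Fin.succAbove_of_le_castSucc _ _ h, if_pos h', if_neg h'.not_gt, Fin.val_succ]
      ring
  simp only [h1, Finset.sum_sub_distrib]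
  nth_rewrite 2 [Finset.sum_comm]
  simp only [← Finset.sum_sub_distrib]
  refine Finset.sum_congr rfl fun s _ => Finset.sum_congr rfl fun t _ => ?_
  split_ifs <;> ring

end Determinant

namespace GF

variable {k A : Type*} [CommRing k] [CommRing A] [Algebra k A]

theorem lie_eq_apply (D : Derivation k A A) (f : A) : ⁅D, f⁆ = D f := rfl

theorem ceTuple'_min_max_succ {L : Type*} [LieRing L] {n : ℕ} (ξ : Fin (n + 2) → L)
    (s : Fin (n + 2)) (j : Fin (n + 1)) (l : Fin n) :
    ceTuple' ξ (min s (s.succAbove j)) (max s (s.succAbove j)) l.succ =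
      ξ (s.succAbove (j.succAbove l)) := by
  rcases lt_or_ge j.castSucc s with h | h
  · rw [Fin.succAbove_of_castSucc_lt _ _ h, min_eq_right h.le, max_eq_left h.le]
    simp only [ceTuple', Fin.succAbove, Fin.lt_def, Fin.val_castSucc, Fin.val_succ] at h ⊢
    split_ifs <;> simp_all <;> first | omega | rfl
  · have h' : s < j.succ := Fin.le_castSucc_iff.mp h
    rw [Fin.succAbove_of_le_castSucc _ _ h, min_eq_left h'.le, max_eq_right h'.le]
    simp only [ceTuple', Fin.succAbove, Fin.lt_def, Fin.le_def, Fin.val_castSucc,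
      Fin.val_succ] at h h' ⊢
    split_ifs <;> simp_all <;> first | omega | rfl

/-- The matrix `(η_j(g_i))`. -/
def evalMatrix {q : ℕ} (g : Fin q → A) (η : Fin q → Derivation k A A) : Matrix (Fin q) (Fin q) A :=
  Matrix.of fun i j => (η j) (g i)

/-- The Chevalley–Eilenberg terms of `det(η_j(g_i))` that involve second derivatives cancel. -/
theorem sum_det_evalMatrix_ceTuple' {q : ℕ} (g : Fin q → A)
    (ξ : Fin (q + 1) → Derivation k A A) :
    (∑ s : Fin (q + 1), ∑ t : Fin (q + 1),
      if s < t then (-1) ^ (s.val + t.val + 1) * (evalMatrix g (ceTuple' ξ s t)).det else 0) =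
    ∑ s : Fin (q + 1), (-1) ^ s.val * ξ s (evalMatrix g fun i => ξ (s.succAbove i)).det := by
  cases q with
  | zero => simp [evalMatrix]
  | succ n =>
    let F (s t : Fin (n + 2)) : A :=
      ((evalMatrix g (ceTuple' ξ (min s t) (max s t))).updateCol 0 fun i => ξ s (ξ t (g i))).det
    have hF (s : Fin (n + 2)) : (-1) ^ s.val * ξ s (evalMatrix g fun i => ξ (s.succAbove i)).det =
        ∑ j : Fin (n + 1), (-1) ^ (s.val + j.val) * F s (s.succAbove j) := by
      rw [Derivation.map_det, Finset.mul_sum]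
      refine Finset.sum_congr rfl fun j _ => ?_
      rw [Matrix.det_updateCol_eq_neg_one_pow_mul_det_cons, ← mul_assoc, ← pow_add]
      congr 2
      ext i l
      refine Fin.cases ?_ (fun l => ?_) l
      · simp [evalMatrix]
      · simp [evalMatrix, ceTuple'_min_max_succ, Matrix.updateCol_ne]
    simp only [hF]
    rw [sum_sum_neg_one_pow_succAbove]
    refine Finset.sum_congr rfl fun s _ => Finset.sum_congr rfl fun t _ => ?_
    split_ifs with hst
    · congr 1
      simp only [F]
      rw [min_comm t, max_comm t, min_eq_left hst.le, max_eq_right hst.le, eq_sub_iff_add_eq]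
      have hC : (evalMatrix g (ceTuple' ξ s t)).updateCol 0 (fun i => ⁅ξ s, ξ t⁆ (g i)) =
          evalMatrix g (ceTuple' ξ s t) :=
        Matrix.updateCol_eq_self _ 0
      nth_rewrite 1 [← hC]
      rw [← Matrix.det_updateCol_add]
      congr 2
      ext i
      simp [Derivation.commutator_apply]
    · rfl

/-- The `A`-linear map `Φ_q` sending `ω₁ ∧ ⋯ ∧ ω_q` to `η ↦ det(⟨ω_i, η_j⟩)`. -/
def deRhamToCochain (k A : Type*) [CommRing k] [CommRing A] [Algebra k A] (q : ℕ) :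
    ⋀[A]^q (KaehlerDifferential k A) →ₗ[A] ((Fin q → Derivation k A A) → A) :=
  LinearMap.pi fun η => exteriorPower.alternatingMapLinearEquiv
    (Matrix.detRowAlternating.compLinearMap
      (LinearMap.pi fun j => (η j).liftKaehlerDifferential))

theorem deRhamToCochain_wedgeD (q : ℕ) (g : Fin q → A) (η : Fin q → Derivation k A A) :
    deRhamToCochain k A q (wedgeD k A q g) η = (evalMatrix g η).det := by
  have h : wedgeD k A q g =
    exteriorPower.ιMulti A q (fun i => KaehlerDifferential.D k A (g i)) := rfl
  rw [h, deRhamToCochain, LinearMap.pi_apply, exteriorPower.alternatingMapLinearEquiv_apply_ιMulti]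
  simp only [AlternatingMap.compLinearMap_apply]
  change Matrix.det _ = _
  congr 1
  ext i j
  simp [evalMatrix]

theorem span_range_wedgeD (q : ℕ) : Submodule.span A (Set.range (wedgeD k A q)) = ⊤ := by
  rw [← exteriorPower.ιMulti_span_of_span A q _ (KaehlerDifferential.span_range_derivation k A)]
  congr 1
  ext ω
  constructor
  · rintro ⟨g, rfl⟩
    exact ⟨_, by rintro _ ⟨i, rfl⟩; exact ⟨g i, rfl⟩, rfl⟩
  · rintro ⟨a, ha, rfl⟩
    choose g hg using fun i => ha ⟨i, rfl⟩
    exact ⟨g, congrArg (exteriorPower.ιMulti A q) (funext hg)⟩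

theorem induction_smul_wedgeD {q : ℕ} {p : ⋀[A]^q (KaehlerDifferential k A) → Prop}
    (zero : p 0) (add : ∀ x y, p x → p y → p (x + y))
    (smul_wedgeD : ∀ (f : A) (g : Fin q → A), p (f • wedgeD k A q g))
    (ω : ⋀[A]^q (KaehlerDifferential k A)) : p ω := by
  have hω : ω ∈ Submodule.span A (Set.range (wedgeD k A q)) := by
    rw [span_range_wedgeD]; trivial
  suffices h : ∀ f : A, p (f • ω) by simpa using h 1
  induction hω using Submodule.span_induction with
  | mem x hx => obtain ⟨g, rfl⟩ := hx; exact fun f => smul_wedgeD f g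
  | zero => intro f; rwa [smul_zero]
  | add x y _ _ hx hy => intro f; rw [smul_add]; exact add _ _ (hx f) (hy f)
  | smul a x _ hx => intro f; rw [smul_smul]; exact hx _

theorem evalMatrix_update {q : ℕ} (g : Fin q → A) (ξ : Fin q → Derivation k A A) (i : Fin q)
    (x : Derivation k A A) :
    evalMatrix g (Function.update ξ i x) = (evalMatrix g ξ).updateCol i fun a => x (g a) := by
  ext a b
  rcases eq_or_ne b i with rfl | h <;> simp [evalMatrix, *]

theorem det_evalMatrix_mem_ceCochainA {q : ℕ} (g : Fin q → A) :
    (fun η => (evalMatrix g η).det) ∈ ceCochainA k A (Derivation k A A) A q := by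
  refine ⟨⟨fun ξ i x y => ?_, fun ξ i c x => ?_, fun ξ i j hij h => ?_⟩, fun f ξ => ?_⟩
  · simp only [evalMatrix_update]
    exact Matrix.det_updateCol_add _ _ _ _
  · simp only [evalMatrix_update]
    rw [Algebra.smul_def, ← Matrix.det_updateCol_smul]
    congr 2
    ext a
    simp [Algebra.smul_def]
  · exact Matrix.det_zero_of_column_eq hij fun a => by simp [evalMatrix, h]
  · exact Matrix.det_mul_row f (evalMatrix g ξ)

theorem smul_mem_ceCochainA {q : ℕ} (f : A) {φ : (Fin q → Derivation k A A) → A}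
    (hφ : φ ∈ ceCochainA k A (Derivation k A A) A q) :
    f • φ ∈ ceCochainA k A (Derivation k A A) A q := by
  obtain ⟨⟨h1, h2, h3⟩, h4⟩ := hφ
  refine ⟨⟨fun ξ i x y => ?_, fun ξ i c x => ?_, fun ξ i j hij h => ?_⟩, fun a ξ => ?_⟩
  · simp only [Pi.smul_apply, h1, smul_add]
  · simp only [Pi.smul_apply, h2, smul_comm f c]
  · simp only [Pi.smul_apply, h3 ξ i j hij h, smul_zero]
  · simp only [Pi.smul_apply, h4 a ξ, smul_comm f]

theorem deRhamToCochain_mem_ceCochainA {q : ℕ} (ω : ⋀[A]^q (KaehlerDifferential k A)) :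
    deRhamToCochain k A q ω ∈ ceCochainA k A (Derivation k A A) A q := by
  induction ω using induction_smul_wedgeD with
  | zero => rw [map_zero]; exact zero_mem _
  | add x y hx hy => rw [map_add]; exact add_mem hx hy
  | smul_wedgeD f g =>
    rw [map_smul, funext (deRhamToCochain_wedgeD q g)]
    exact smul_mem_ceCochainA f (det_evalMatrix_mem_ceCochainA g)

theorem ceDiff_smul_det_evalMatrix {q : ℕ} (f : A) (g : Fin q → A) :
    ceDiff k (Derivation k A A) A q (fun η => f * (evalMatrix g η).det) =
      fun ξ => -(evalMatrix (Fin.cons f g : Fin (q + 1) → A) ξ).det := by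
  funext ξ
  have h1 : (∑ s : Fin (q + 1), ∑ t : Fin (q + 1), if s < t then
      ((-1 : ℤ) ^ (s.val + t.val + 1)) • (f * (evalMatrix g (ceTuple' ξ s t)).det) else 0) =
      f * ∑ s : Fin (q + 1), ∑ t : Fin (q + 1),
        if s < t then (-1) ^ (s.val + t.val + 1) * (evalMatrix g (ceTuple' ξ s t)).det else 0 := by
    simp only [Finset.mul_sum]
    refine Finset.sum_congr rfl fun s _ => Finset.sum_congr rfl fun t _ => ?_
    split_ifs
    · rw [zsmul_eq_mul]; push_cast; ring
    · rw [mul_zero]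
  simp only [ceDiff, LinearMap.coe_mk, AddHom.coe_mk]
  rw [h1, sum_det_evalMatrix_ceTuple', Matrix.det_succ_row_zero, Finset.mul_sum,
    ← Finset.sum_add_distrib, ← Finset.sum_neg_distrib]
  refine Finset.sum_congr rfl fun s _ => ?_
  have h2 : (evalMatrix (Fin.cons f g : Fin (q + 1) → A) ξ).submatrix Fin.succ s.succAbove =
      evalMatrix g fun i => ξ (s.succAbove i) := by
    ext i j; simp [evalMatrix]
  have h3 : evalMatrix (Fin.cons f g : Fin (q + 1) → A) ξ 0 s = ξ s f := rfl
  rw [h2, h3, lie_eq_apply, Derivation.leibniz, zsmul_eq_mul]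
  push_cast
  simp only [smul_eq_mul]
  ring

end GF

open GF in
/-- STATEMENT 3: for a unital commutative `k`-algebra `A` (char `k = 0`) with
`V = Der_k(A)`, the assignment `Φ_q(f dg₁∧⋯∧dg_q)(η₁∧⋯∧η_q) = f·det(η_j(g_i))` defines
`A`-module maps `Φ_q : Ω^q_{A/k} → Hom_A(Λ^q_A V, A)` (realized as `A`-multilinear
alternating cochains), and `d ∘ Φ_q = Φ_{q+1} ∘ (−d_dR)` where `d` is the
Chevalley–Eilenberg differential on `C_A^*(V, A)`. -/
theorem deRham_to_cochains
    (k A : Type*) [Field k] [CharZero k] [CommRing A] [Algebra k A]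
    (dDR : (q : ℕ) →
      (⋀[A]^q (KaehlerDifferential k A) →ₗ[k] ⋀[A]^(q + 1) (KaehlerDifferential k A)))
    (hdDR : IsDeRhamDiff k A dDR) :
    ∃ Φ : (q : ℕ) →
      (⋀[A]^q (KaehlerDifferential k A) →ₗ[A] ((Fin q → Derivation k A A) → A)),
      (∀ (q : ℕ) (f : A) (g : Fin q → A),
        Φ q (f • wedgeD k A q g)
          = fun η : Fin q → Derivation k A A =>
              f * Matrix.det (Matrix.of fun i j : Fin q => (η j) (g i))) ∧
      (∀ (q : ℕ) (ω : ⋀[A]^q (KaehlerDifferential k A)),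
        Φ q ω ∈ ceCochainA k A (Derivation k A A) A q) ∧
      (∀ (q : ℕ) (ω : ⋀[A]^q (KaehlerDifferential k A)),
        ceDiff k (Derivation k A A) A q (Φ q ω) = Φ (q + 1) (- dDR q ω)) := by
  refine ⟨deRhamToCochain k A, fun q f g => ?_, fun q => deRhamToCochain_mem_ceCochainA,
    fun q ω => ?_⟩
  · rw [map_smul, funext (deRhamToCochain_wedgeD q g)]
    rfl
  · induction ω using induction_smul_wedgeD with
    | zero => simp
    | add x y hx hy => rw [map_add, map_add, hx, hy, map_add, neg_add, map_add]
    | smul_wedgeD f g =>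
      rw [hdDR, map_smul, map_neg, funext (deRhamToCochain_wedgeD q g),
        funext (deRhamToCochain_wedgeD (q + 1) _)]
      exact ceDiff_smul_det_evalMatrix f g
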